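/- arXiv:2402.00970 — 13 statements merged into one kernel-verified Lean document; each statement's English description precedes it below -/
import Mathlib

section
/- Let L be a logic interpreted over a set P of processes and let φ ∈ L. If the subsets S ⊆ P and T ⊆ P both represent φ, then for every p ∈ S there exists q ∈ T such that L(p) = L(q), and for every q ∈ T there exists p ∈ S such that L(p) = L(q). -/
/-- `SatSet sem p` is the set `L(p)` of formulae satisfied by process `p`. -/
def SatSet {L P : Type*} (sem : L → Set P) (p : P) : Set L := {φ | p ∈ sem φ}

/-- The upwards closure `↑p = {q | L(p) ⊆ L(q)}`. -/
def UpClos {L P : Type*} (sem : L → Set P) (p : P) : Set P :=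
  {q | SatSet sem p ⊆ SatSet sem q}

/-- `φ` is characteristic for `p`. -/
def Characteristic {L P : Type*} (sem : L → Set P) (φ : L) (p : P) : Prop :=
  ∀ q, q ∈ sem φ ↔ SatSet sem p ⊆ SatSet sem q

/-- `φ` is consistent. -/
def Consistent {L P : Type*} (sem : L → Set P) (φ : L) : Prop := sem φ ≠ ∅

/-- `φ` is prime. -/
def IsPrime {L P : Type*} (sem : L → Set P) (φ : L) : Prop :=
  ∀ Ψ : Finset L, Ψ.Nonempty → sem φ ⊆ ⋃ ψ ∈ Ψ, sem ψ → ∃ ψ ∈ Ψ, sem φ ⊆ sem ψ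

/-- `p` and `q` are incomparable. -/
def Incomparable {L P : Type*} (sem : L → Set P) (p q : P) : Prop :=
  ¬ SatSet sem p ⊆ SatSet sem q ∧ ¬ SatSet sem q ⊆ SatSet sem p

/-- `S` (graphically) represents `φ`. -/
def Represents {L P : Type*} (sem : L → Set P) (S : Set P) (φ : L) : Prop :=
  S.Pairwise (Incomparable sem) ∧ sem φ = ⋃ p ∈ S, UpClos sem p

/-- `φ` is finitely represented. -/
def FinitelyRepresented {L P : Type*} (sem : L → Set P) (φ : L) : Prop :=
  ∃ S : Set P, S.Finite ∧ Represents sem S φ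

/-- A formula is decomposable. -/
def FormulaDecomposable {L P : Type*} (sem : L → Set P) (φ : L) : Prop :=
  ∃ (p : P) (χp ψ : L), Characteristic sem χp p ∧ p ∉ sem ψ ∧
    sem φ = sem χp ∪ sem ψ

/-- The logic is decomposable. -/
def LogicDecomposable {L P : Type*} (sem : L → Set P) : Prop :=
  ∀ φ, Consistent sem φ → FormulaDecomposable sem φ ∨ ∃ p, Characteristic sem φ p

/-- The logic features conjunction. -/
def FeaturesConj {L P : Type*} (sem : L → Set P) : Prop :=
  ∃ conj : L → L → L, ∀ φ ψ, sem (conj φ ψ) = sem φ ∩ sem ψ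

/-- The logic features disjunction. -/
def FeaturesDisj {L P : Type*} (sem : L → Set P) : Prop :=
  ∃ disj : L → L → L, ∀ φ ψ, sem (disj φ ψ) = sem φ ∪ sem ψ

/-- The logic is characterized by `B`. -/
def CharacterizedBy {L P : Type*} (sem : L → Set P) (B : P → Set L) : Prop :=
  ∀ p, (B p).Nonempty ∧ B p ⊆ SatSet sem p ∧
    ∀ φ ∈ SatSet sem p, (⋂ ψ ∈ B p, sem ψ) ⊆ sem φ

/-- The logic is finitely characterized by `B`. -/
def FinitelyCharacterizedBy {L P : Type*} (sem : L → Set P) (B : P → Set L) : Prop :=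
  CharacterizedBy sem B ∧ ∀ p, (B p).Finite

/-- `B` is monotonic. -/
def Monotonic {L P : Type*} (sem : L → Set P) (B : P → Set L) : Prop :=
  ∀ p q, SatSet sem p ⊆ SatSet sem q → B p ⊆ B q

/-- `p` is a minimal element of `S`. -/
def MinimalIn {L P : Type*} (sem : L → Set P) (S : Set P) (p : P) : Prop :=
  p ∈ S ∧ ∀ q ∈ S, SatSet sem q ⊆ SatSet sem p → SatSet sem q = SatSet sem p

/-- If `S` and `T` both represent `φ`, every element of `S` is equivalent to one of `T`. -/
theorem Represents.exists_satSet_eq {L P : Type*} {sem : L → Set P} {φ : L} {S T : Set P}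
    (hS : Represents sem S φ) (hT : Represents sem T φ) {p : P} (hp : p ∈ S) :
    ∃ q ∈ T, SatSet sem p = SatSet sem q := by
  have hST : ⋃ p ∈ S, UpClos sem p = ⋃ q ∈ T, UpClos sem q := hS.2.symm.trans hT.2
  have hpT : p ∈ ⋃ q ∈ T, UpClos sem q :=
    hST ▸ Set.mem_biUnion hp (Set.Subset.refl (SatSet sem p))
  obtain ⟨q, hq, hqp⟩ := Set.mem_iUnion₂.mp hpT
  have hqS : q ∈ ⋃ p ∈ S, UpClos sem p :=
    hST ▸ Set.mem_biUnion hq (Set.Subset.refl (SatSet sem q))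
  obtain ⟨r, hr, hrq⟩ := Set.mem_iUnion₂.mp hqS
  have hrp : r = p := hS.1.eq hr hp fun h => h.1 (Set.Subset.trans hrq hqp)
  subst hrp
  exact ⟨q, hq, Set.Subset.antisymm hrq hqp⟩

theorem stmt3 {L P : Type*} [Nonempty P] (sem : L → Set P) (φ : L) (S T : Set P)
    (hS : Represents sem S φ) (hT : Represents sem T φ) :
    (∀ p ∈ S, ∃ q ∈ T, SatSet sem p = SatSet sem q) ∧
      (∀ q ∈ T, ∃ p ∈ S, SatSet sem p = SatSet sem q) := by
  refine ⟨fun p hp => hS.exists_satSet_eq hT hp, fun q hq => ?_⟩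
  obtain ⟨p, hp, h⟩ := hT.exists_satSet_eq hS hq
  exact ⟨p, hp, h.symm⟩
end

section
/- Let L be a logic interpreted over a set P of processes and let φ ∈ L. If φ is a characteristic formula for some p ∈ P, then φ is prime and consistent. -/
theorem stmt4 {L P : Type*} [Nonempty P] (sem : L → Set P) (φ : L) (p : P)
    (h : Characteristic sem φ p) :
    IsPrime sem φ ∧ Consistent sem φ := by
  have hp : p ∈ sem φ := (h p).2 subset_rfl
  refine ⟨fun Ψ _ hΨ => ?_, Set.nonempty_iff_ne_empty.1 ⟨p, hp⟩⟩
  obtain ⟨ψ, hψ, hpψ⟩ := Set.mem_iUnion₂.1 (hΨ hp)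
  exact ⟨ψ, hψ, fun q hq => (h q).1 hq hpψ⟩
end

section
/- Let L be a logic interpreted over a set P of processes, let φ, ψ ∈ L and p ∈ P, and let χp be a characteristic formula for p. If p ∉ ⟦ψ⟧, φ is prime, and ⟦φ⟧ = ⟦χp⟧ ∪ ⟦ψ⟧, then ⟦φ⟧ = ⟦χp⟧. -/
theorem stmt5 {L P : Type*} [Nonempty P] (sem : L → Set P) (φ ψ χp : L) (p : P)
    (hχ : Characteristic sem χp p) (hψ : p ∉ sem ψ) (hφ : IsPrime sem φ)
    (heq : sem φ = sem χp ∪ sem ψ) :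
    sem φ = sem χp := by
  classical
  obtain ⟨θ, hθ, hsub⟩ := hφ {χp, ψ} (by simp) (by simp [heq])
  have hp : p ∈ sem χp := (hχ p).2 subset_rfl
  rw [Finset.mem_insert, Finset.mem_singleton] at hθ
  rcases hθ with rfl | rfl
  · exact hsub.antisymm (heq ▸ Set.subset_union_left)
  · exact absurd (hsub (heq ▸ Or.inl hp)) hψ
end

section
/- Let L be a logic interpreted over a set P of processes. If L is decomposable, then every formula in L that is consistent and prime is a characteristic formula for some p ∈ P. -/
theorem stmt6 {L P : Type*} [Nonempty P] (sem : L → Set P)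
    (hdec : LogicDecomposable sem) (φ : L)
    (hcons : Consistent sem φ) (hprime : IsPrime sem φ) :
    ∃ p, Characteristic sem φ p := by
  classical
  obtain ⟨p, χ, ψ, hχ, hpψ, hφ⟩ | h := hdec φ hcons
  · have hχφ : sem χ ⊆ sem φ := hφ ▸ Set.subset_union_left
    obtain ⟨θ, hθ, hsub⟩ := hprime {χ, ψ} (by simp) (by simp [hφ])
    rw [Finset.mem_insert, Finset.mem_singleton] at hθ
    obtain rfl | rfl := hθ
    · refine ⟨p, fun q => ?_⟩
      rw [hsub.antisymm hχφ]
      exact hχ q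
    · exact absurd (hsub (hχφ ((hχ p).2 subset_rfl))) hpψ
  · exact h
end

section
/- Let L be a logic interpreted over a set P of processes such that (i) every p ∈ P has a characteristic formula χ(p) in L, and (ii) for each consistent formula φ there exist p ∈ ⟦φ⟧ and ψp ∈ L such that p ∉ ⟦ψp⟧ and ⟦φ⟧ \ ⟦χ(p)⟧ ⊆ ⟦ψp⟧ ⊆ ⟦φ⟧. Then L is decomposable. -/
theorem stmt7 {L P : Type*} [Nonempty P] (sem : L → Set P) (χ : P → L)
    (hχ : ∀ p, Characteristic sem (χ p) p)
    (h2 : ∀ φ, Consistent sem φ → ∃ p ∈ sem φ, ∃ ψp : L,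
      p ∉ sem ψp ∧ sem φ \ sem (χ p) ⊆ sem ψp ∧ sem ψp ⊆ sem φ) :
    LogicDecomposable sem := by
  intro φ hφ
  obtain ⟨p, hp, ψ, hpψ, hsub, hψ⟩ := h2 φ hφ
  have hχφ : sem (χ p) ⊆ sem φ := fun q hq => (hχ p q).1 hq hp
  exact Or.inl ⟨p, χ p, ψ, hχ p, hpψ,
    (Set.sdiff_subset_iff.1 hsub).antisymm (Set.union_subset hχφ hψ)⟩
end

section
/- Let L be a logic interpreted over a set P of processes that features conjunction, such that every p ∈ P has a characteristic formula χ(p) in L, and such that for each p ∈ P there exists a formula χ̄(p) ∈ L with ⟦χ̄(p)⟧ = P \ ⟦χ(p)⟧. Then L is decomposable. -/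
theorem stmt8 {L P : Type*} [Nonempty P] (sem : L → Set P)
    (hconj : FeaturesConj sem) (χ : P → L)
    (hχ : ∀ p, Characteristic sem (χ p) p)
    (hbar : ∀ p, ∃ χbar : L, sem χbar = (sem (χ p))ᶜ) :
    LogicDecomposable sem := by
  intro φ hφ
  obtain ⟨p, hp⟩ := Set.nonempty_iff_ne_empty.mpr hφ
  obtain ⟨conj, hconj⟩ := hconj
  obtain ⟨χbar, hbar⟩ := hbar p
  have hpχ : p ∈ sem (χ p) := (hχ p p).mpr subset_rfl
  have hsub : sem (χ p) ⊆ sem φ := fun q hq => (hχ p q).mp hq hp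
  refine .inl ⟨p, χ p, conj φ χbar, hχ p, ?_, ?_⟩
  · simp [hconj, hbar, hpχ]
  · rw [hconj, hbar, ← Set.sdiff_eq, Set.union_sdiff_cancel hsub]
end

section
/- Let L be a logic interpreted over a set P of processes that features conjunction and such that: (i) every p ∈ P has a characteristic formula χ(p) in L, (ii) for each consistent formula φ the set ⟦φ⟧ has a minimal element, and (iii) for each p ∈ P there is a formula χ̄(p) ∈ L such that either ⟦χ̄(p)⟧ = P \ ⟦χ(p)⟧, or both p ∉ ⟦χ̄(p)⟧ and {q ∈ P | L(q) ⊄ L(p)} ⊆ ⟦χ̄(p)⟧. Then L is decomposable. -/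
theorem stmt10 {L P : Type*} [Nonempty P] (sem : L → Set P)
    (hconj : FeaturesConj sem) (χ : P → L)
    (hχ : ∀ p, Characteristic sem (χ p) p)
    (hmin : ∀ φ, Consistent sem φ → ∃ p, MinimalIn sem (sem φ) p)
    (hbar : ∀ p, ∃ χbar : L, sem χbar = (sem (χ p))ᶜ ∨
      (p ∉ sem χbar ∧ {q : P | ¬ SatSet sem q ⊆ SatSet sem p} ⊆ sem χbar)) :
    LogicDecomposable sem := by
  obtain ⟨conj, hc⟩ := hconj
  intro φ hφ
  obtain ⟨p, hpφ, hp⟩ := hmin φ hφ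
  obtain ⟨χbar, hb⟩ := hbar p
  have hpχ : p ∈ sem (χ p) := (hχ p p).2 subset_rfl
  have hpb : p ∉ sem χbar := by
    rcases hb with hb | hb
    · rw [hb]
      exact fun h => h hpχ
    · exact hb.1
  refine Or.inl ⟨p, χ p, conj φ χbar, hχ p, fun h => hpb (hc φ χbar ▸ h).2, ?_⟩
  rw [hc]
  refine Set.Subset.antisymm (fun q hq => ?_)
    (Set.union_subset (fun q hq => (hχ p q).1 hq hpφ) Set.inter_subset_left)
  by_cases hqχ : q ∈ sem (χ p)
  · exact Or.inl hqχ
  · refine Or.inr ⟨hq, ?_⟩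
    rcases hb with hb | hb
    · rw [hb]
      exact hqχ
    · exact hb.2 fun hle => hqχ ((hχ p q).2 (hp q hq hle).symm.subset)
end

section
/- Let L be a logic interpreted over a set P of processes that features conjunction and is finitely characterized by a function B : P → Set L. Then every p ∈ P has a characteristic formula in L; in particular, any formula χ ∈ L with ⟦χ⟧ = ⋂_{ψ ∈ B(p)} ⟦ψ⟧ is characteristic for p. -/
/-- In a logic with conjunction, a finite nonempty intersection of denotations is a denotation. -/
theorem FeaturesConj.exists_sem_eq_biInter {L P : Type*} {sem : L → Set P}
    (hconj : FeaturesConj sem) {S : Set L} (hS : S.Finite) (hne : S.Nonempty) :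
    ∃ χ : L, sem χ = ⋂ ψ ∈ S, sem ψ := by
  obtain ⟨conj, hc⟩ := hconj
  induction S, hS using Set.Finite.induction_on with
  | empty => exact absurd hne Set.not_nonempty_empty
  | @insert a S _ _ ih =>
    rcases S.eq_empty_or_nonempty with rfl | hS
    · exact ⟨a, by simp⟩
    · obtain ⟨χ, hχ⟩ := ih hS
      exact ⟨conj a χ, by rw [hc, hχ, Set.biInter_insert]⟩

/-- A formula denoting the intersection over `B p` is characteristic for `p`. -/
theorem CharacterizedBy.characteristic {L P : Type*} {sem : L → Set P} {B : P → Set L}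
    (hB : CharacterizedBy sem B) {p : P} {χ : L} (hχ : sem χ = ⋂ ψ ∈ B p, sem ψ) :
    Characteristic sem χ p := by
  obtain ⟨-, hsub, hinter⟩ := hB p
  intro q
  rw [hχ]
  exact ⟨fun hq φ hφ => hinter φ hφ hq, fun h => Set.mem_iInter₂.2 fun ψ hψ => h (hsub hψ)⟩

theorem stmt12 {L P : Type*} [Nonempty P] (sem : L → Set P)
    (hconj : FeaturesConj sem) (B : P → Set L)
    (hB : FinitelyCharacterizedBy sem B) :
    (∀ p, ∃ χ : L, Characteristic sem χ p) ∧
      (∀ (p : P) (χ : L), sem χ = ⋂ ψ ∈ B p, sem ψ → Characteristic sem χ p) := by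
  refine ⟨fun p => ?_, fun p χ hχ => hB.1.characteristic hχ⟩
  obtain ⟨χ, hχ⟩ := hconj.exists_sem_eq_biInter (hB.2 p) (hB.1 p).1
  exact ⟨χ, hB.1.characteristic hχ⟩
end

section
/- Let L be a logic interpreted over a set P of processes that is finitely characterized by a monotonic function B : P → Set L. Then for each formula φ ∈ L and each q ∈ ⟦φ⟧, there exists p ∈ ⟦φ⟧ such that L(p) ⊆ L(q) and p is minimal in ⟦φ⟧. In particular, for each consistent formula φ the set ⟦φ⟧ has a minimal element. -/
/-- If `B r` contains `B p`, then `r` satisfies every formula satisfied by `p`. -/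
theorem CharacterizedBy.satSet_subset {L P : Type*} {sem : L → Set P} {B : P → Set L}
    (hB : CharacterizedBy sem B) {p r : P} (h : B p ⊆ B r) : SatSet sem p ⊆ SatSet sem r :=
  fun φ hφ => (hB p).2.2 φ hφ (Set.mem_iInter₂.2 fun _ hψ => (hB r).2.1 (h hψ))

/-- Below every process in a set `S` there is a minimal element of `S`. -/
theorem exists_minimalIn_of_finitelyCharacterizedBy {L P : Type*} {sem : L → Set P}
    {B : P → Set L} (hB : FinitelyCharacterizedBy sem B) (hmono : Monotonic sem B)
    {S : Set P} {q : P} (hq : q ∈ S) :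
    ∃ p ∈ S, SatSet sem p ⊆ SatSet sem q ∧ MinimalIn sem S p := by
  obtain ⟨p, ⟨hpS, hpq⟩, hmin⟩ := exists_minimalFor_of_wellFoundedLT
    (fun r => r ∈ S ∧ SatSet sem r ⊆ SatSet sem q) (fun r => (B r).ncard)
    ⟨q, hq, subset_rfl⟩
  refine ⟨p, hpS, hpq, hpS, fun r hr hrp => hrp.antisymm (hB.1.satSet_subset ?_)⟩
  have hsub := hmono r p hrp
  exact (Set.eq_of_subset_of_ncard_le hsub
    (hmin ⟨hr, hrp.trans hpq⟩ (Set.ncard_le_ncard hsub (hB.2 p))) (hB.2 p)).ge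

theorem stmt13 {L P : Type*} [Nonempty P] (sem : L → Set P) (B : P → Set L)
    (hB : FinitelyCharacterizedBy sem B) (hmono : Monotonic sem B) :
    (∀ (φ : L), ∀ q ∈ sem φ, ∃ p ∈ sem φ,
      SatSet sem p ⊆ SatSet sem q ∧ MinimalIn sem (sem φ) p) ∧
      (∀ φ : L, Consistent sem φ → ∃ p, MinimalIn sem (sem φ) p) := by
  refine ⟨fun φ q hq => exists_minimalIn_of_finitelyCharacterizedBy hB hmono hq, fun φ hφ => ?_⟩
  obtain ⟨q, hq⟩ := Set.nonempty_iff_ne_empty.2 hφ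
  obtain ⟨p, -, -, hp⟩ := exists_minimalIn_of_finitelyCharacterizedBy hB hmono hq
  exact ⟨p, hp⟩
end

section
/- Let L be a logic interpreted over a set P of processes such that (i) L features disjunction, (ii) every formula φ ∈ L is finitely represented, and (iii) every p ∈ P has a characteristic formula in L. Then L is decomposable. -/
/-- Characteristic formulae define principal upwards closures. -/
theorem Characteristic.sem_eq {L P : Type*} {sem : L → Set P} {χ : L} {p : P}
    (h : Characteristic sem χ p) : sem χ = UpClos sem p :=
  Set.ext h

/-- With disjunction and characteristic formulae, finite nonempty unions of upwards closures
are definable. -/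
theorem FeaturesDisj.exists_sem_eq_biUnion {L P : Type*} {sem : L → Set P}
    (hdisj : FeaturesDisj sem) (hχ : ∀ p : P, ∃ χ : L, Characteristic sem χ p)
    {S : Set P} (hS : S.Finite) (hne : S.Nonempty) :
    ∃ ψ : L, sem ψ = ⋃ p ∈ S, UpClos sem p := by
  obtain ⟨disj, hd⟩ := hdisj
  induction S, hS using Set.Finite.induction_on with
  | empty => exact absurd hne Set.not_nonempty_empty
  | @insert p T _ _ ih =>
    obtain ⟨χ, hp⟩ := hχ p
    rcases T.eq_empty_or_nonempty with rfl | hT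
    · exact ⟨χ, by simp [hp.sem_eq]⟩
    · obtain ⟨ψ, hψ⟩ := ih hT
      exact ⟨disj χ ψ, by rw [hd, hp.sem_eq, hψ, Set.biUnion_insert]⟩

theorem stmt16 {L P : Type*} [Nonempty P] (sem : L → Set P)
    (hdisj : FeaturesDisj sem)
    (hrep : ∀ φ : L, FinitelyRepresented sem φ)
    (hχ : ∀ p : P, ∃ χ : L, Characteristic sem χ p) :
    LogicDecomposable sem := by
  intro φ hφ
  obtain ⟨S, hfin, hinc, hS⟩ := hrep φ
  have hne : S.Nonempty := by
    rw [Set.nonempty_iff_ne_empty]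
    rintro rfl
    exact hφ (by simpa using hS)
  obtain ⟨p, hp⟩ := hne
  obtain ⟨χ, hχp⟩ := hχ p
  have hsplit : sem φ = sem χ ∪ ⋃ q ∈ S \ {p}, UpClos sem q := by
    rw [hS, hχp.sem_eq, ← Set.biUnion_insert, Set.insert_sdiff_singleton,
      Set.insert_eq_of_mem hp]
  rcases (S \ {p}).eq_empty_or_nonempty with hT | hT
  · refine Or.inr ⟨p, fun q => ?_⟩
    rw [hsplit, hT, Set.biUnion_empty, Set.union_empty]
    exact hχp q
  · obtain ⟨ψ, hψ⟩ := hdisj.exists_sem_eq_biUnion hχ (hfin.subset Set.sdiff_subset) hT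
    refine Or.inl ⟨p, χ, ψ, hχp, ?_, by rw [hsplit, hψ]⟩
    rw [hψ, Set.mem_iUnion₂]
    rintro ⟨q, ⟨hq, hqp⟩, hle⟩
    exact (hinc hq hp hqp).1 hle
end

section
/- Let L be a logic interpreted over a finite set P of processes that features conjunction, and assume L(p) ≠ ∅ for each p ∈ P. Then (a) L is finitely characterized by some monotonic function B : P → Set L, and (b) every formula φ ∈ L is finitely represented. -/
/-- A logic over finitely many processes is finitely characterized by the monotonic function that
sends `p` to the formulae of `L(p)` in a fixed system of representatives up to logical
equivalence. -/
theorem exists_finitelyCharacterizedBy_monotonic {L P : Type*} [Finite P] (sem : L → Set P)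
    (hne : ∀ p : P, (SatSet sem p).Nonempty) :
    ∃ B : P → Set L, FinitelyCharacterizedBy sem B ∧ Monotonic sem B := by
  have hrep : ∀ p, ∀ φ ∈ SatSet sem p, ∃ ψ ∈ SatSet sem p ∩ Set.range (Set.rangeSplitting sem),
      sem ψ = sem φ := by
    intro p φ hφ
    have h := Set.apply_rangeSplitting sem ⟨sem φ, φ, rfl⟩
    refine ⟨_, ⟨?_, ⟨sem φ, φ, rfl⟩, rfl⟩, h⟩
    change p ∈ sem _
    rw [h]
    exact hφ
  refine ⟨fun p => SatSet sem p ∩ Set.range (Set.rangeSplitting sem), ⟨fun p => ⟨?_, ?_, ?_⟩, ?_⟩,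
    fun p q h => Set.inter_subset_inter_left _ h⟩
  · obtain ⟨φ, hφ⟩ := hne p
    obtain ⟨ψ, hψ, -⟩ := hrep p φ hφ
    exact ⟨ψ, hψ⟩
  · exact Set.inter_subset_left
  · intro φ hφ
    obtain ⟨ψ, hψ, h⟩ := hrep p φ hφ
    rw [← h]
    exact Set.biInter_subset_of_mem hψ
  · exact fun p => (Set.finite_range _).inter_of_right _

/-- Every formula over finitely many processes is represented by a choice of one process from each
equivalence class of minimal elements of its semantics. -/
theorem finitelyRepresented_of_finite {L P : Type*} [Finite P] (sem : L → Set P) (φ : L) :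
    FinitelyRepresented sem φ := by
  refine ⟨Set.range (Set.rangeSplitting (SatSet sem)) ∩ {p | MinimalIn sem (sem φ) p},
    Set.toFinite _, ?_, ?_⟩
  · rintro _ ⟨⟨s, rfl⟩, hs⟩ _ ⟨⟨t, rfl⟩, ht⟩ hst
    have hne : SatSet sem (Set.rangeSplitting (SatSet sem) s) ≠
        SatSet sem (Set.rangeSplitting (SatSet sem) t) := by
      rw [Set.apply_rangeSplitting (SatSet sem), Set.apply_rangeSplitting (SatSet sem)]
      exact fun h => hst (congrArg _ (Subtype.ext h))
    exact ⟨fun h => hne (ht.2 _ hs.1 h), fun h => hne (hs.2 _ ht.1 h).symm⟩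
  · ext q
    simp only [Set.mem_iUnion]
    constructor
    · intro hq
      obtain ⟨s, hsq, ⟨p, hp, rfl⟩, hmin⟩ :=
        ((Set.toFinite (sem φ)).image (SatSet sem)).exists_le_minimal
          (Set.mem_image_of_mem (SatSet sem) hq)
      have h := Set.apply_rangeSplitting (SatSet sem) ⟨SatSet sem p, p, rfl⟩
      refine ⟨_, ⟨⟨⟨SatSet sem p, p, rfl⟩, rfl⟩, ?_, ?_⟩, h.subset.trans hsq⟩
      · change φ ∈ SatSet sem _
        rw [h]
        exact hp
      · intro r hr hrp
        rw [h] at hrp ⊢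
        exact hrp.antisymm (hmin (Set.mem_image_of_mem _ hr) hrp)
    · rintro ⟨p, ⟨-, hp⟩, hpq⟩
      exact hpq hp.1

theorem stmt17 {L P : Type*} [Nonempty P] [Finite P] (sem : L → Set P)
    (hconj : FeaturesConj sem)
    (hne : ∀ p : P, (SatSet sem p).Nonempty) :
    (∃ B : P → Set L, FinitelyCharacterizedBy sem B ∧ Monotonic sem B) ∧
      (∀ φ : L, FinitelyRepresented sem φ) := by
  exact ⟨exists_finitelyCharacterizedBy_monotonic sem hne, finitelyRepresented_of_finite sem⟩
end

section
/- Let L be a logic interpreted over a finite set P of processes that features conjunction and disjunction, and assume L(p) ≠ ∅ for each p ∈ P. Then L is decomposable. -/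
theorem FeaturesConj.infClosed_range {L P : Type*} {sem : L → Set P} (h : FeaturesConj sem) :
    InfClosed (Set.range sem) := by
  obtain ⟨conj, hconj⟩ := h
  rintro _ ⟨φ, rfl⟩ _ ⟨ψ, rfl⟩
  exact ⟨conj φ ψ, hconj φ ψ⟩

theorem FeaturesDisj.supClosed_range {L P : Type*} {sem : L → Set P} (h : FeaturesDisj sem) :
    SupClosed (Set.range sem) := by
  obtain ⟨disj, hdisj⟩ := h
  rintro _ ⟨φ, rfl⟩ _ ⟨ψ, rfl⟩
  exact ⟨disj φ ψ, hdisj φ ψ⟩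

theorem exists_characteristic {L P : Type*} [Finite P] {sem : L → Set P}
    (hconj : FeaturesConj sem) {p : P} (hp : (SatSet sem p).Nonempty) :
    ∃ χ, Characteristic sem χ p := by
  obtain ⟨χ, hχ⟩ := hconj.infClosed_range.sInf_mem_of_nonempty (Set.toFinite _) (hp.image sem)
    (Set.image_subset_range _ _)
  refine ⟨χ, fun q => ?_⟩
  simp [hχ, Set.subset_def, SatSet]

theorem stmt18 {L P : Type*} [Nonempty P] [Finite P] (sem : L → Set P)
    (hconj : FeaturesConj sem) (hdisj : FeaturesDisj sem)
    (hne : ∀ p : P, (SatSet sem p).Nonempty) :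
    LogicDecomposable sem := by
  choose χ hχ using fun p => exists_characteristic hconj (hne p)
  intro φ hφ
  obtain ⟨p, hpφ, hmin⟩ := (Set.toFinite (sem φ)).exists_minimalFor (SatSet sem) _
    (Set.nonempty_iff_ne_empty.mpr hφ)
  rcases Set.eq_empty_or_nonempty (sem φ \ UpClos sem p) with hT | hT
  · exact .inr ⟨p, fun q => ⟨fun hq => Set.sdiff_eq_empty.mp hT hq, fun hq => hq hpφ⟩⟩
  obtain ⟨ψ, hψ⟩ := hdisj.supClosed_range.biSup_mem_of_nonempty
    (f := fun q => sem (χ q)) (Set.toFinite _) hT (fun q _ => ⟨χ q, rfl⟩)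
  have mem_ψ (r : P) : r ∈ sem ψ ↔
      ∃ q ∈ sem φ \ UpClos sem p, SatSet sem q ⊆ SatSet sem r := by
    simp only [hψ, Set.iSup_eq_iUnion, Set.mem_iUnion, hχ _ _, exists_prop]
  refine .inl ⟨p, χ p, ψ, hχ p, ?_, ?_⟩
  · rw [mem_ψ]
    rintro ⟨q, ⟨hqφ, hpq⟩, hqp⟩
    exact hpq (hmin hqφ hqp)
  · ext r
    rw [Set.mem_union, hχ p r, mem_ψ]
    constructor
    · intro hr
      by_cases hpr : SatSet sem p ⊆ SatSet sem r
      · exact .inl hpr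
      · exact .inr ⟨r, ⟨hr, hpr⟩, subset_rfl⟩
    · rintro (hpr | ⟨q, hq, hqr⟩)
      · exact hpr hpφ
      · exact hqr hq.1
end

section
/- Let L be a logic interpreted over a finite set P of processes that features conjunction and disjunction, and assume L(p) ≠ ∅ for each p ∈ P. Then a formula φ ∈ L is consistent and prime if and only if φ is characteristic for some p ∈ P. -/
theorem Characteristic.mem {L P : Type*} {sem : L → Set P} {φ : L} {p : P}
    (h : Characteristic sem φ p) : p ∈ sem φ :=
  (h p).2 subset_rfl

theorem Characteristic.consistent {L P : Type*} {sem : L → Set P} {φ : L} {p : P}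
    (h : Characteristic sem φ p) : Consistent sem φ :=
  Set.nonempty_iff_ne_empty.1 ⟨p, h.mem⟩

theorem Characteristic.isPrime {L P : Type*} {sem : L → Set P} {φ : L} {p : P}
    (h : Characteristic sem φ p) : IsPrime sem φ := by
  intro Ψ _ hsub
  obtain ⟨ψ, hψ, hp⟩ := Set.mem_iUnion₂.1 (hsub h.mem)
  exact ⟨ψ, hψ, fun q hq => (h q).1 hq hp⟩

theorem exists_characteristic_of_consistent_of_isPrime {L P : Type*} [Finite P]
    {sem : L → Set P} (hχ : ∀ p, ∃ χ, Characteristic sem χ p) {φ : L}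
    (hcons : Consistent sem φ) (hprime : IsPrime sem φ) : ∃ p, Characteristic sem φ p := by
  choose χ hχ using hχ
  have hfin : (χ '' sem φ).Finite := Set.toFinite _
  have hcover : sem φ ⊆ ⋃ ψ ∈ hfin.toFinset, sem ψ := fun q hq =>
    Set.mem_iUnion₂.2 ⟨χ q, hfin.mem_toFinset.2 ⟨q, hq, rfl⟩, (hχ q).mem⟩
  obtain ⟨ψ, hψ, hsub⟩ := hprime hfin.toFinset
    (hfin.toFinset_nonempty.2 ((Set.nonempty_iff_ne_empty.2 hcons).image χ)) hcover
  obtain ⟨p, hp, rfl⟩ := hfin.mem_toFinset.1 hψ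
  exact ⟨p, fun q => ⟨fun hq => (hχ p q).1 (hsub hq), fun h => h hp⟩⟩

theorem stmt19 {L P : Type*} [Nonempty P] [Finite P] (sem : L → Set P)
    (hconj : FeaturesConj sem) (hdisj : FeaturesDisj sem)
    (hne : ∀ p : P, (SatSet sem p).Nonempty) (φ : L) :
    (Consistent sem φ ∧ IsPrime sem φ) ↔ ∃ p, Characteristic sem φ p := by
  constructor
  · rintro ⟨hcons, hprime⟩
    exact exists_characteristic_of_consistent_of_isPrime
      (fun p => exists_characteristic hconj (hne p)) hcons hprime
  · rintro ⟨p, h⟩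
    exact ⟨h.consistent, h.isPrime⟩
end
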